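/- arXiv:1108.1387 — 2 statements merged into one kernel-verified Lean document; each statement's English description precedes it below -/
import Mathlib

section
/- (Theorem 1D: necessary condition for the surface fractional Hardy–Sobolev inequality.) Let d ≥ 2 and 1 ≤ m ≤ d−1 be integers, p, q ∈ (1,∞), and α₁, α₂, β, μ ∈ ℝ. Let S = {x ∈ ℝ^d : x_{m+1} = … = x_d = 0} with its m-dimensional Lebesgue surface measure, and set L^S_{q,μ}(u) = (∫_{ℝ^m} |u((x′,0))|^q |x′|^{−μ} dx′)^{1/q}. Suppose there is a constant K ∈ (0,∞) such that L^S_{q,μ}(u) ≤ K · R_{p,α₁,α₂,β}(u) for every u ∈ C_c^∞(ℝ^d), and suppose there exists u₀ ∈ C_c^∞(ℝ^d) with L^S_{q,μ}(u₀) > 0 and R_{p,α₁,α₂,β}(u₀) < ∞. Then (m−μ)/q = (2d+α₁+α₂−β)/p. -/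
open MeasureTheory ENNReal

/-- Embedding of `ℝ^m` into `ℝ^d` as the coordinate subspace
`S = {x : x_{m+1} = … = x_d = 0}`. -/
noncomputable def coordEmbed (m d : ℕ) (x : EuclideanSpace ℝ (Fin m)) :
    EuclideanSpace ℝ (Fin d) :=
  (EuclideanSpace.equiv (Fin d) ℝ).symm
    (fun i => if hi : (i : ℕ) < m then x ⟨(i : ℕ), hi⟩ else 0)

/-- Surface functional
`L^S_{q,μ}(u) = (∫_{ℝ^m} |u((x′,0))|^q |x′|^{−μ} dx′)^{1/q}`, in `[0,∞]`. -/
noncomputable def HSsurf (d m : ℕ) (q μ : ℝ)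
    (u : EuclideanSpace ℝ (Fin d) → ℝ) : ℝ≥0∞ :=
  (∫⁻ x' : EuclideanSpace ℝ (Fin m),
      ENNReal.ofReal (|u (coordEmbed m d x')| ^ q * ‖x'‖ ^ (-μ))) ^ (1 / q)

/-- `R_{p,α₁,α₂,β}(u) = (∫∫ |u(x)−u(y)|^p |x|^{α₁} |y|^{α₂} |x−y|^{−β} dx dy)^{1/p}`,
with values in `[0,∞]`. -/
noncomputable def HSright (d : ℕ) (p α₁ α₂ β : ℝ)
    (u : EuclideanSpace ℝ (Fin d) → ℝ) : ℝ≥0∞ :=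
  (∫⁻ x : EuclideanSpace ℝ (Fin d), ∫⁻ y : EuclideanSpace ℝ (Fin d),
      ENNReal.ofReal (|u x - u y| ^ p * ‖x‖ ^ α₁ * ‖y‖ ^ α₂ * ‖x - y‖ ^ (-β))) ^ (1 / p)

/-- Change of variables `x ↦ r • x` for the lower Lebesgue integral. -/
theorem lintegral_comp_pos_smul {E : Type*} [NormedAddCommGroup E] [NormedSpace ℝ E]
    [MeasurableSpace E] [BorelSpace E] [FiniteDimensional ℝ E] (ν : Measure E)
    [ν.IsAddHaarMeasure] (f : E → ℝ≥0∞) {r : ℝ} (hr : 0 < r) :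
    ∫⁻ x, f (r • x) ∂ν = ENNReal.ofReal (r ^ (-(Module.finrank ℝ E : ℝ))) * ∫⁻ x, f x ∂ν := by
  have h := lintegral_map_equiv (μ := ν) f (Homeomorph.smulOfNeZero r hr.ne').toMeasurableEquiv
  have hmap := Measure.map_addHaar_smul ν hr.ne'
  have hcoe : ⇑(Homeomorph.smulOfNeZero r hr.ne' : E ≃ₜ E).toMeasurableEquiv = (r • ·) := rfl
  rw [hcoe, hmap, lintegral_smul_measure, smul_eq_mul, abs_of_nonneg (by positivity)] at h
  rw [← h, Real.rpow_neg hr.le, Real.rpow_natCast]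

theorem coordEmbed_smul (m d : ℕ) (r : ℝ) (x : EuclideanSpace ℝ (Fin m)) :
    coordEmbed m d (r • x) = r • coordEmbed m d x := by
  ext i
  by_cases hi : (i : ℕ) < m <;> simp [coordEmbed, hi]

theorem norm_smul_rpow {E : Type*} [NormedAddCommGroup E] [NormedSpace ℝ E] {r : ℝ}
    (hr : 0 < r) (a : ℝ) (x : E) : ‖x‖ ^ a = r ^ (-a) * ‖r • x‖ ^ a := by
  rw [norm_smul, Real.norm_of_nonneg hr.le, Real.mul_rpow hr.le (norm_nonneg x), ← mul_assoc,
    ← Real.rpow_add hr, neg_add_cancel, Real.rpow_zero, one_mul]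

/-- Scaling of the surface functional under dilations. -/
theorem HSsurf_comp_smul (d m : ℕ) {q : ℝ} (hq : 0 < q) (μ : ℝ)
    (u : EuclideanSpace ℝ (Fin d) → ℝ) {r : ℝ} (hr : 0 < r) :
    HSsurf d m q μ (fun x => u (r • x)) =
      ENNReal.ofReal (r ^ (-((m - μ) / q))) * HSsurf d m q μ u := by
  have key (x : EuclideanSpace ℝ (Fin m)) :
      ENNReal.ofReal (|u (r • coordEmbed m d x)| ^ q * ‖x‖ ^ (-μ)) =
        ENNReal.ofReal (r ^ μ) *
          ENNReal.ofReal (|u (coordEmbed m d (r • x))| ^ q * ‖r • x‖ ^ (-μ)) := by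
    rw [← ENNReal.ofReal_mul (by positivity), coordEmbed_smul, norm_smul_rpow hr (-μ) x, neg_neg]
    ring_nf
  simp only [HSsurf, key]
  rw [lintegral_const_mul' _ _ ENNReal.ofReal_ne_top,
    lintegral_comp_pos_smul volume
      (fun x => ENNReal.ofReal (|u (coordEmbed m d x)| ^ q * ‖x‖ ^ (-μ))) hr,
    finrank_euclideanSpace_fin, ← mul_assoc, ← ENNReal.ofReal_mul (by positivity),
    ← Real.rpow_add hr, ENNReal.mul_rpow_of_nonneg _ _ (by positivity),
    ENNReal.ofReal_rpow_of_pos (by positivity), ← Real.rpow_mul hr.le]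
  congr 3
  ring

/-- Scaling of the double integral under dilations. -/
theorem HSright_comp_smul (d : ℕ) {p : ℝ} (hp : 0 < p) (α₁ α₂ β : ℝ)
    (u : EuclideanSpace ℝ (Fin d) → ℝ) {r : ℝ} (hr : 0 < r) :
    HSright d p α₁ α₂ β (fun x => u (r • x)) =
      ENNReal.ofReal (r ^ (-((2 * d + α₁ + α₂ - β) / p))) * HSright d p α₁ α₂ β u := by
  set G : EuclideanSpace ℝ (Fin d) → EuclideanSpace ℝ (Fin d) → ℝ≥0∞ := fun x y =>
    ENNReal.ofReal (|u x - u y| ^ p * ‖x‖ ^ α₁ * ‖y‖ ^ α₂ * ‖x - y‖ ^ (-β)) with hG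
  have key (x y : EuclideanSpace ℝ (Fin d)) :
      ENNReal.ofReal
          (|u (r • x) - u (r • y)| ^ p * ‖x‖ ^ α₁ * ‖y‖ ^ α₂ * ‖x - y‖ ^ (-β)) =
        ENNReal.ofReal (r ^ (-α₁ - α₂ + β)) * G (r • x) (r • y) := by
    rw [hG, ← ENNReal.ofReal_mul (by positivity), norm_smul_rpow hr α₁ x, norm_smul_rpow hr α₂ y,
      norm_smul_rpow hr (-β) (x - y), smul_sub, sub_eq_add_neg (-α₁), Real.rpow_add hr,
      Real.rpow_add hr, neg_neg]
    ring_nf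
  have inner (x : EuclideanSpace ℝ (Fin d)) : ∫⁻ y, G (r • x) (r • y) =
      ENNReal.ofReal (r ^ (-(d : ℝ))) * ∫⁻ y, G (r • x) y := by
    simpa using lintegral_comp_pos_smul volume (G (r • x)) hr
  have outer : ∫⁻ x, ∫⁻ y, G (r • x) y =
      ENNReal.ofReal (r ^ (-(d : ℝ))) * ∫⁻ x, ∫⁻ y, G x y := by
    simpa using lintegral_comp_pos_smul volume (fun x => ∫⁻ y, G x y) hr
  simp only [HSright, key, lintegral_const_mul' _ _ ENNReal.ofReal_ne_top, inner, outer]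
  rw [← mul_assoc, ← mul_assoc, ← ENNReal.ofReal_mul (by positivity),
    ← ENNReal.ofReal_mul (by positivity), ← Real.rpow_add hr, ← Real.rpow_add hr,
    ENNReal.mul_rpow_of_nonneg _ _ (by positivity),
    ENNReal.ofReal_rpow_of_pos (by positivity), ← Real.rpow_mul hr.le]
  congr 3
  ring

/-- Two exponents agree if the corresponding powers are comparable on all of `(0, ∞)`. -/
theorem eq_of_forall_rpow_mul_le {a b A B : ℝ} (hA : 0 < A)
    (h : ∀ r : ℝ, 0 < r → r ^ (-a) * A ≤ r ^ (-b) * B) : a = b := by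
  by_contra hab
  have hab' : b - a ≠ 0 := sub_ne_zero.mpr (Ne.symm hab)
  have hB : 0 < B := by simpa using hA.trans_le (by simpa using h 1 one_pos)
  have hs : 0 < 2 * B / A := by positivity
  have hr : 0 < (2 * B / A) ^ (b - a)⁻¹ := Real.rpow_pos_of_pos hs _
  have h1 := h _ hr
  set r := (2 * B / A) ^ (b - a)⁻¹ with hrdef
  have hpow : r ^ (b - a) = 2 * B / A := Real.rpow_inv_rpow hs.le hab'
  have h2 := mul_le_mul_of_nonneg_left h1 (Real.rpow_nonneg hr.le b)
  rw [← mul_assoc, ← mul_assoc, ← Real.rpow_add hr, ← Real.rpow_add hr, ← sub_eq_add_neg, hpow,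
    add_neg_cancel, Real.rpow_zero, div_mul_cancel₀ _ hA.ne'] at h2
  linarith

/-- Theorem 1D: necessary condition for the surface fractional
Hardy–Sobolev inequality on `ℝ^d`. -/
theorem necessary_condition_surface_HS
    (d m : ℕ) (hd : 2 ≤ d) (hm : 1 ≤ m) (hmd : m ≤ d - 1)
    (p q α₁ α₂ β μ : ℝ) (hp : 1 < p) (hq : 1 < q)
    (K : ℝ) (hK : 0 < K)
    (hineq : ∀ u : EuclideanSpace ℝ (Fin d) → ℝ,
      ContDiff ℝ (⊤ : ℕ∞) u → HasCompactSupport u →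
        HSsurf d m q μ u ≤ ENNReal.ofReal K * HSright d p α₁ α₂ β u)
    (hex : ∃ u₀ : EuclideanSpace ℝ (Fin d) → ℝ,
      ContDiff ℝ (⊤ : ℕ∞) u₀ ∧ HasCompactSupport u₀ ∧
        0 < HSsurf d m q μ u₀ ∧ HSright d p α₁ α₂ β u₀ < ⊤) :
    ((m : ℝ) - μ) / q = (2 * (d : ℝ) + α₁ + α₂ - β) / p := by
  obtain ⟨u, hu, hc, hpos, hfin⟩ := hex
  have hKR : ENNReal.ofReal K * HSright d p α₁ α₂ β u ≠ ⊤ :=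
    ENNReal.mul_ne_top ENNReal.ofReal_ne_top hfin.ne
  have hL : HSsurf d m q μ u ≠ ⊤ := ne_top_of_le_ne_top hKR (hineq u hu hc)
  refine eq_of_forall_rpow_mul_le (ENNReal.toReal_pos hpos.ne' hL)
    (B := (ENNReal.ofReal K * HSright d p α₁ α₂ β u).toReal) fun r hr => ?_
  have h := hineq (fun x => u (r • x)) (hu.comp (contDiff_const_smul r))
    (hc.comp_homeomorph (Homeomorph.smulOfNeZero r hr.ne'))
  rw [HSsurf_comp_smul d m (by linarith) μ u hr,
    HSright_comp_smul d (by linarith) α₁ α₂ β u hr, mul_left_comm] at h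
  have h' := ENNReal.toReal_mono (ENNReal.mul_ne_top ENNReal.ofReal_ne_top hKR) h
  rwa [ENNReal.toReal_mul, ENNReal.toReal_mul, ENNReal.toReal_ofReal (by positivity),
    ENNReal.toReal_ofReal (by positivity)] at h'
end

section
/- (Theorem 4.a.) Let d ≥ 1 be an integer and λ ∈ (0, 1/(2d−1)). For p ∈ (1, 1/λ) set μ(p) = λdp, β(p) = d(1+λp), and define the optimal fractional Hardy–Sobolev constant K̄(p) = sup { L_{p,μ(p)}(u) / R_{p,0,0,β(p)}(u) : u ∈ C_c^∞(ℝ^d), R_{p,0,0,β(p)}(u) ≠ 0 }. Then there exist constants C₁, C₂ ∈ (0,∞) depending only on λ and d such that for all p ∈ (1, 1/λ): C₁ · (p/(1/λ − p))^{λ} ≤ K̄(p) ≤ C₂ · p/(1/λ − p). -/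
open MeasureTheory ENNReal

/-- `L_{p,μ}(u) = (∫_{ℝ^d} |u(x)|^p |x|^{−μ} dx)^{1/p}`, in `[0,∞]`. -/
noncomputable def HSleft (d : ℕ) (p μ : ℝ) (u : EuclideanSpace ℝ (Fin d) → ℝ) : ℝ≥0∞ :=
  (∫⁻ x : EuclideanSpace ℝ (Fin d),
      ENNReal.ofReal (|u x| ^ p * ‖x‖ ^ (-μ))) ^ (1 / p)

/-- Optimal fractional Hardy–Sobolev constant
`K̄ = sup { L_{p,μ}(u) / R_{p,α₁,α₂,β}(u) : u ∈ C_c^∞, R ≠ 0 }`, in `[0,∞]`. -/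
noncomputable def HSoptConst (d : ℕ) (p μ α₁ α₂ β : ℝ) : ℝ≥0∞ :=
  ⨆ u : {u : EuclideanSpace ℝ (Fin d) → ℝ //
      ContDiff ℝ (⊤ : ℕ∞) u ∧ HasCompactSupport u ∧ HSright d p α₁ α₂ β u ≠ 0},
    HSleft d p μ u.1 / HSright d p α₁ α₂ β u.1

lemma lintegral_annulus_norm_rpow_neg (d : ℕ) {a : ℝ} (ha : 0 < a) :
    ∫⁻ x : EuclideanSpace ℝ (Fin d),
        Set.indicator {x | a ≤ ‖x‖ ∧ ‖x‖ ≤ 2 * a} (fun x ↦ ENNReal.ofReal (‖x‖ ^ (-(d : ℝ)))) x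
      = ∫⁻ x : EuclideanSpace ℝ (Fin d),
        Set.indicator {x | 1 ≤ ‖x‖ ∧ ‖x‖ ≤ 2} (fun x ↦ ENNReal.ofReal (‖x‖ ^ (-(d : ℝ)))) x := by
  set F : EuclideanSpace ℝ (Fin d) → ℝ≥0∞ :=
    Set.indicator {x | a ≤ ‖x‖ ∧ ‖x‖ ≤ 2 * a} (fun x ↦ ENNReal.ofReal (‖x‖ ^ (-(d : ℝ)))) with hF
  have hmeas : Measurable F := by
    refine Measurable.indicator (by fun_prop) ?_
    exact ((measurableSet_le measurable_const measurable_norm).inter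
      (measurableSet_le measurable_norm measurable_const))
  have h1 := lintegral_map (μ := (volume : Measure (EuclideanSpace ℝ (Fin d)))) hmeas
    (measurable_const_smul a)
  rw [Measure.map_addHaar_smul _ ha.ne', lintegral_smul_measure, finrank_euclideanSpace_fin] at h1
  have hpos : 0 < a ^ d := by positivity
  have h2 : ∀ x : EuclideanSpace ℝ (Fin d), F (a • x) = ENNReal.ofReal (abs (a ^ d)⁻¹) *
      Set.indicator {x | 1 ≤ ‖x‖ ∧ ‖x‖ ≤ 2} (fun x ↦ ENNReal.ofReal (‖x‖ ^ (-(d : ℝ)))) x := by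
    intro x
    have hn : ‖a • x‖ = a * ‖x‖ := by rw [norm_smul, Real.norm_of_nonneg ha.le]
    have hiff : (a ≤ a * ‖x‖ ∧ a * ‖x‖ ≤ 2 * a) ↔ (1 ≤ ‖x‖ ∧ ‖x‖ ≤ 2) := by
      rw [mul_comm 2 a, mul_le_mul_iff_right₀ ha, le_mul_iff_one_le_right ha]
    by_cases h : 1 ≤ ‖x‖ ∧ ‖x‖ ≤ 2
    · rw [hF, Set.indicator_of_mem (by simpa [hn] using hiff.2 h), Set.indicator_of_mem (by simpa),
        hn, Real.mul_rpow ha.le (norm_nonneg x), ENNReal.ofReal_mul (by positivity),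
        abs_of_pos (by positivity), Real.rpow_neg ha.le, Real.rpow_natCast]
    · rw [hF, Set.indicator_of_notMem (by simpa [hn] using fun h' ↦ (not_and.1 (mt hiff.1 h)) h'),
        Set.indicator_of_notMem (by simpa using h), mul_zero]
  simp_rw [h2] at h1
  rw [lintegral_const_mul' _ _ ENNReal.ofReal_ne_top, smul_eq_mul] at h1
  exact (ENNReal.mul_right_inj (by simp [ha.ne', abs_pos]) ENNReal.ofReal_ne_top).1 h1

lemma lintegral_annulus_ne_top (d : ℕ) :
    ∫⁻ x : EuclideanSpace ℝ (Fin d),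
      Set.indicator {x | 1 ≤ ‖x‖ ∧ ‖x‖ ≤ 2} (fun x ↦ ENNReal.ofReal (‖x‖ ^ (-(d : ℝ)))) x ≠ ∞ := by
  refine ne_top_of_le_ne_top (b := volume (Metric.closedBall (0 : EuclideanSpace ℝ (Fin d)) 2))
    measure_closedBall_lt_top.ne ?_
  rw [← lintegral_indicator_one measurableSet_closedBall]
  refine lintegral_mono fun x ↦ ?_
  by_cases h : 1 ≤ ‖x‖ ∧ ‖x‖ ≤ 2
  · have hx : x ∈ {x : EuclideanSpace ℝ (Fin d) | 1 ≤ ‖x‖ ∧ ‖x‖ ≤ 2} := h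
    rw [Set.indicator_of_mem hx, Set.indicator_of_mem (by simpa using h.2)]
    exact ENNReal.ofReal_le_one.2
      (Real.rpow_le_one_of_one_le_of_nonpos h.1 (neg_nonpos.2 d.cast_nonneg))
  · rw [Set.indicator_of_notMem (by simpa using h)]
    exact zero_le

lemma lintegral_annulus_pos {d : ℕ} (hd : 1 ≤ d) :
    0 < ∫⁻ x : EuclideanSpace ℝ (Fin d),
      Set.indicator {x | 1 ≤ ‖x‖ ∧ ‖x‖ ≤ 2} (fun x ↦ ENNReal.ofReal (‖x‖ ^ (-(d : ℝ)))) x := by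
  have : Nonempty (Fin d) := ⟨⟨0, hd⟩⟩
  have hmeas : MeasurableSet {x : EuclideanSpace ℝ (Fin d) | 1 ≤ ‖x‖ ∧ ‖x‖ ≤ 2} :=
    (measurableSet_le measurable_const measurable_norm).inter
      (measurableSet_le measurable_norm measurable_const)
  rw [lintegral_pos_iff_support (Measurable.indicator (by fun_prop) hmeas)]
  obtain ⟨x₀, hx₀⟩ := exists_norm_eq (EuclideanSpace ℝ (Fin d)) (c := 3 / 2) (by norm_num)
  have hopen : IsOpen {x : EuclideanSpace ℝ (Fin d) | 1 < ‖x‖ ∧ ‖x‖ < 2} :=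
    (isOpen_lt continuous_const continuous_norm).inter (isOpen_lt continuous_norm continuous_const)
  refine (hopen.measure_pos volume ⟨x₀, by norm_num [hx₀]⟩).trans_le (measure_mono ?_)
  rintro x ⟨h1, h2⟩
  have hx : x ∈ {x : EuclideanSpace ℝ (Fin d) | 1 ≤ ‖x‖ ∧ ‖x‖ ≤ 2} := ⟨h1.le, h2.le⟩
  rw [Function.mem_support, Set.indicator_of_mem hx]
  have : 0 < ‖x‖ := one_pos.trans h1
  exact (ENNReal.ofReal_pos.2 (Real.rpow_pos_of_pos this _)).ne'

lemma integrableOn_ball_norm_rpow {d : ℕ} (hd : 1 ≤ d) {a : ℝ} (ha : a < d) {r : ℝ} (hr : 0 < r) :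
    IntegrableOn (fun x : EuclideanSpace ℝ (Fin d) ↦ ‖x‖ ^ (-a)) (Metric.ball 0 r) := by
  have : Nonempty (Fin d) := ⟨⟨0, hd⟩⟩
  rw [integrableOn_fun_norm_addHaar volume (f := fun y ↦ y ^ (-a)),
    finrank_euclideanSpace_fin]
  have h : IntegrableOn (fun y : ℝ ↦ y ^ ((d : ℝ) - 1 - a)) (Set.Ioo 0 r) :=
    (intervalIntegral.integrableOn_Ioo_rpow_iff hr).2 (by linarith)
  refine h.congr_fun (fun y hy ↦ ?_) measurableSet_Ioo
  simp only [smul_eq_mul]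
  rw [← Real.rpow_natCast, ← Real.rpow_add hy.1, Nat.cast_sub hd]
  simp [sub_eq_add_neg]

lemma setIntegral_ball_norm_rpow {d : ℕ} (hd : 1 ≤ d) {a : ℝ} (ha : a < d) :
    ∫ x in Metric.ball (0 : EuclideanSpace ℝ (Fin d)) 1, ‖x‖ ^ (-a) =
      d * volume.real (Metric.ball (0 : EuclideanSpace ℝ (Fin d)) 1) / (d - a) := by
  have : Nonempty (Fin d) := ⟨⟨0, hd⟩⟩
  rw [← integral_indicator measurableSet_ball]
  have h1 := integral_fun_norm_addHaar (volume : Measure (EuclideanSpace ℝ (Fin d)))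
    ((Set.Iio (1 : ℝ)).indicator fun y ↦ y ^ (-a))
  have h2 : ∀ x : EuclideanSpace ℝ (Fin d),
      (Metric.ball (0 : EuclideanSpace ℝ (Fin d)) 1).indicator (fun x ↦ ‖x‖ ^ (-a)) x =
        (Set.Iio (1 : ℝ)).indicator (fun y ↦ y ^ (-a)) ‖x‖ := by
    intro x; simp [Set.indicator]
  simp_rw [h2]
  rw [h1, finrank_euclideanSpace_fin]
  have h3 : ∫ y in Set.Ioi (0 : ℝ), y ^ (d - 1) • (Set.Iio (1 : ℝ)).indicator (fun y ↦ y ^ (-a)) y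
      = 1 / (d - a) := by
    have h4 : ∀ y : ℝ, y ^ (d - 1) • (Set.Iio (1 : ℝ)).indicator (fun y ↦ y ^ (-a)) y
        = (Set.Iio (1 : ℝ)).indicator (fun y ↦ y ^ (d - 1) * y ^ (-a)) y := by
      intro y; by_cases h : y < 1 <;> simp [h]
    simp_rw [h4]
    rw [setIntegral_indicator measurableSet_Iio, Set.Ioi_inter_Iio]
    rw [setIntegral_congr_fun (g := fun y : ℝ ↦ y ^ ((d : ℝ) - 1 - a)) measurableSet_Ioo,
      ← integral_Ioc_eq_integral_Ioo, ← intervalIntegral.integral_of_le zero_le_one,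
      integral_rpow (Or.inl (by linarith))]
    · have : (d : ℝ) - 1 - a + 1 = d - a := by ring
      rw [this, Real.one_rpow, Real.zero_rpow (by linarith), sub_zero]
    · intro y hy
      simp only
      rw [← Real.rpow_natCast, ← Real.rpow_add hy.1, Nat.cast_sub hd]
      simp [sub_eq_add_neg]
  rw [h3]
  simp only [smul_eq_mul, nsmul_eq_mul]
  ring

/-- The weight `|x|^{-σ} |y|^{-d}` on the set of pairs with `2|x| ≤ |y| ≤ 4|x|`. -/
noncomputable def dyadicWeight (d : ℕ) (σ : ℝ)
    (q : EuclideanSpace ℝ (Fin d) × EuclideanSpace ℝ (Fin d)) : ℝ≥0∞ :=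
  Set.indicator {q | 2 * ‖q.1‖ ≤ ‖q.2‖ ∧ ‖q.2‖ ≤ 4 * ‖q.1‖}
    (fun q ↦ ENNReal.ofReal (‖q.1‖ ^ (-σ) * ‖q.2‖ ^ (-(d : ℝ)))) q

/-- The logarithmic mass of an annulus of ratio two. -/
noncomputable def annulusMass (d : ℕ) : ℝ≥0∞ :=
  ∫⁻ x : EuclideanSpace ℝ (Fin d),
    Set.indicator {x | 1 ≤ ‖x‖ ∧ ‖x‖ ≤ 2} (fun x ↦ ENNReal.ofReal (‖x‖ ^ (-(d : ℝ)))) x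

lemma measurable_dyadicWeight (d : ℕ) (σ : ℝ) : Measurable (dyadicWeight d σ) := by
  refine Measurable.indicator (by fun_prop) ?_
  exact (measurableSet_le (measurable_fst.norm.const_mul 2) measurable_snd.norm).inter
    (measurableSet_le measurable_snd.norm (measurable_fst.norm.const_mul 4))

lemma lintegral_dyadicWeight_right {d : ℕ} {σ : ℝ} (hσ : 0 < σ) (x : EuclideanSpace ℝ (Fin d)) :
    ∫⁻ y, dyadicWeight d σ (x, y) = annulusMass d * ENNReal.ofReal (‖x‖ ^ (-σ)) := by
  rcases eq_or_ne x 0 with rfl | hx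
  · simp [dyadicWeight, Set.indicator, Real.zero_rpow (neg_ne_zero.2 hσ.ne')]
  have hx' : 0 < 2 * ‖x‖ := by positivity
  rw [annulusMass, ← lintegral_annulus_norm_rpow_neg d hx', mul_comm,
    ← lintegral_const_mul' _ _ ENNReal.ofReal_ne_top]
  refine lintegral_congr fun y ↦ ?_
  have h4 : 2 * (2 * ‖x‖) = 4 * ‖x‖ := by ring
  by_cases h : 2 * ‖x‖ ≤ ‖y‖ ∧ ‖y‖ ≤ 4 * ‖x‖
  · simp [dyadicWeight, Set.indicator, h4, h, ENNReal.ofReal_mul (Real.rpow_nonneg (norm_nonneg x) _)]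
  · simp [dyadicWeight, Set.indicator, h4, h]

lemma lintegral_dyadicWeight_left_le {d : ℕ} (hd : 1 ≤ d) {σ : ℝ} (hσd : σ < d)
    (y : EuclideanSpace ℝ (Fin d)) :
    ∫⁻ x, dyadicWeight d σ (x, y) ≤
      annulusMass d * ENNReal.ofReal ((1 / 2) ^ ((d : ℝ) - σ) * ‖y‖ ^ (-σ)) := by
  rcases eq_or_ne y 0 with rfl | hy
  · simp [dyadicWeight, Set.indicator, show d ≠ 0 by omega]
  have hy' : 0 < ‖y‖ := norm_pos_iff.2 hy
  have hy4 : 0 < ‖y‖ / 4 := by positivity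
  rw [annulusMass, ← lintegral_annulus_norm_rpow_neg d hy4, mul_comm,
    ← lintegral_const_mul' _ _ ENNReal.ofReal_ne_top]
  refine lintegral_mono fun x ↦ ?_
  by_cases h : 2 * ‖x‖ ≤ ‖y‖ ∧ ‖y‖ ≤ 4 * ‖x‖
  · have h' : ‖y‖ / 4 ≤ ‖x‖ ∧ ‖x‖ ≤ 2 * (‖y‖ / 4) := ⟨by linarith, by linarith⟩
    simp only [dyadicWeight, Set.indicator, Set.mem_ofPred_eq, h, h', and_self, if_true]
    rw [← ENNReal.ofReal_mul (by positivity)]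
    refine ENNReal.ofReal_le_ofReal ?_
    have hx : 0 < ‖x‖ := hy4.trans_le h'.1
    have e1 : ‖x‖ ^ (-σ) = ‖x‖ ^ (-(d : ℝ)) * ‖x‖ ^ ((d : ℝ) - σ) := by
      rw [← Real.rpow_add hx]; congr 1; ring
    have e2 : ‖x‖ ^ ((d : ℝ) - σ) ≤ (1 / 2) ^ ((d : ℝ) - σ) * ‖y‖ ^ ((d : ℝ) - σ) := by
      rw [← Real.mul_rpow (by norm_num) hy'.le]
      exact Real.rpow_le_rpow hx.le (by linarith) (by linarith)
    have e3 : ‖y‖ ^ ((d : ℝ) - σ) * ‖y‖ ^ (-(d : ℝ)) = ‖y‖ ^ (-σ) := by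
      rw [← Real.rpow_add hy']; congr 1; ring
    calc ‖x‖ ^ (-σ) * ‖y‖ ^ (-(d : ℝ))
        = ‖x‖ ^ ((d : ℝ) - σ) * (‖x‖ ^ (-(d : ℝ)) * ‖y‖ ^ (-(d : ℝ))) := by rw [e1]; ring
      _ ≤ (1 / 2) ^ ((d : ℝ) - σ) * ‖y‖ ^ ((d : ℝ) - σ) *
          (‖x‖ ^ (-(d : ℝ)) * ‖y‖ ^ (-(d : ℝ))) := by gcongr
      _ = _ := by rw [← e3]; ring
  · simp [dyadicWeight, Set.indicator, h]

lemma dyadicWeight_mul_le {d : ℕ} {σ p : ℝ} (hσ : 0 < σ) (hp : 0 < p)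
    (u : EuclideanSpace ℝ (Fin d) → ℝ) (x y : EuclideanSpace ℝ (Fin d)) :
    dyadicWeight d σ (x, y) * ENNReal.ofReal (|u x - u y| ^ p) ≤
      ENNReal.ofReal (5 ^ ((d : ℝ) + σ)) *
        ENNReal.ofReal (|u x - u y| ^ p * ‖x - y‖ ^ (-((d : ℝ) + σ))) := by
  rcases eq_or_ne x y with rfl | hxy
  · simp [Real.zero_rpow hp.ne']
  by_cases h : 2 * ‖x‖ ≤ ‖y‖ ∧ ‖y‖ ≤ 4 * ‖x‖
  · simp only [dyadicWeight, Set.indicator, Set.mem_ofPred_eq, h, and_self, if_true]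
    rw [← ENNReal.ofReal_mul (by positivity), ← ENNReal.ofReal_mul (by positivity)]
    refine ENNReal.ofReal_le_ofReal ?_
    have hz : 0 < ‖x - y‖ / 5 := by
      have := norm_pos_iff.2 (sub_ne_zero.2 hxy)
      positivity
    have htri := norm_sub_le x y
    have hx : ‖x - y‖ / 5 ≤ ‖x‖ := by linarith
    have hy : ‖x - y‖ / 5 ≤ ‖y‖ := by linarith [norm_nonneg x]
    have key : ‖x‖ ^ (-σ) * ‖y‖ ^ (-(d : ℝ)) ≤
        5 ^ ((d : ℝ) + σ) * ‖x - y‖ ^ (-((d : ℝ) + σ)) := by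
      calc ‖x‖ ^ (-σ) * ‖y‖ ^ (-(d : ℝ))
          ≤ (‖x - y‖ / 5) ^ (-σ) * (‖x - y‖ / 5) ^ (-(d : ℝ)) := by
            gcongr ?_ * ?_
            · exact Real.rpow_le_rpow_of_nonpos hz hx (by linarith)
            · exact Real.rpow_le_rpow_of_nonpos hz hy (by simp)
        _ = (‖x - y‖ / 5) ^ (-((d : ℝ) + σ)) := by
            rw [← Real.rpow_add hz]; congr 1; ring
        _ = 5 ^ ((d : ℝ) + σ) * ‖x - y‖ ^ (-((d : ℝ) + σ)) := by
            rw [Real.div_rpow (norm_nonneg _) (by norm_num),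
              Real.rpow_neg (show (0 : ℝ) ≤ 5 by norm_num), div_inv_eq_mul, mul_comm]
    calc _ ≤ 5 ^ ((d : ℝ) + σ) * ‖x - y‖ ^ (-((d : ℝ) + σ)) * |u x - u y| ^ p := by gcongr
      _ = _ := by ring
  · simp [dyadicWeight, Set.indicator, h]

/-- Minkowski's inequality for `u(x) = (u(x) - u(y)) + u(y)` on the dyadic pairs `(x, y)`. -/
lemma annulusMass_mul_lintegral_rpow_le {d : ℕ} (hd : 1 ≤ d) {σ p : ℝ} (hσ : 0 < σ) (hσd : σ < d)
    (hp : 1 ≤ p) {u : EuclideanSpace ℝ (Fin d) → ℝ} (hu : Measurable u) :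
    (annulusMass d * ∫⁻ x, ENNReal.ofReal (|u x| ^ p * ‖x‖ ^ (-σ))) ^ (1 / p) ≤
      (ENNReal.ofReal (5 ^ ((d : ℝ) + σ)) *
        ∫⁻ x, ∫⁻ y, ENNReal.ofReal (|u x - u y| ^ p * ‖x - y‖ ^ (-((d : ℝ) + σ)))) ^ (1 / p) +
      (annulusMass d * (ENNReal.ofReal ((1 / 2) ^ ((d : ℝ) - σ)) *
        ∫⁻ x, ENNReal.ofReal (|u x| ^ p * ‖x‖ ^ (-σ)))) ^ (1 / p) := by
  have hp0 : 0 < p := by linarith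
  have hM : annulusMass d ≠ ∞ := lintegral_annulus_ne_top d
  have hw := measurable_dyadicWeight d σ
  set ν := ((volume : Measure (EuclideanSpace ℝ (Fin d))).prod
    (volume : Measure (EuclideanSpace ℝ (Fin d)))).withDensity (dyadicWeight d σ) with hν
  have hmink := ENNReal.lintegral_Lp_add_le (μ := ν) (p := p)
    (f := fun q ↦ ENNReal.ofReal |u q.1 - u q.2|) (g := fun q ↦ ENNReal.ofReal |u q.2|)
    (by fun_prop) (by fun_prop) hp
  have hle : ∫⁻ q, ENNReal.ofReal |u q.1| ^ p ∂ν ≤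
      ∫⁻ q, ((fun q : EuclideanSpace ℝ (Fin d) × EuclideanSpace ℝ (Fin d) ↦
        ENNReal.ofReal |u q.1 - u q.2|) +
        fun q : EuclideanSpace ℝ (Fin d) × EuclideanSpace ℝ (Fin d) ↦
          ENNReal.ofReal |u q.2|) q ^ p ∂ν := by
    refine lintegral_mono fun q ↦ ENNReal.rpow_le_rpow ?_ hp0.le
    rw [Pi.add_apply, ← ENNReal.ofReal_add (abs_nonneg _) (abs_nonneg _)]
    refine ENNReal.ofReal_le_ofReal ?_
    simpa using abs_add_le (u q.1 - u q.2) (u q.2)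
  have h1 : ∫⁻ q, ENNReal.ofReal |u q.1| ^ p ∂ν =
      annulusMass d * ∫⁻ x, ENNReal.ofReal (|u x| ^ p * ‖x‖ ^ (-σ)) := by
    rw [hν, lintegral_withDensity_eq_lintegral_mul _ hw (by fun_prop),
      lintegral_prod _ (by fun_prop), ← lintegral_const_mul' _ _ hM]
    refine lintegral_congr fun x ↦ ?_
    simp only [Pi.mul_apply]
    rw [lintegral_mul_const _ (by fun_prop), lintegral_dyadicWeight_right hσ,
      ENNReal.ofReal_mul (by positivity), ENNReal.ofReal_rpow_of_nonneg (abs_nonneg _) hp0.le,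
      mul_assoc, mul_comm (ENNReal.ofReal (|u x| ^ p))]
  have h2 : ∫⁻ q, ENNReal.ofReal |u q.1 - u q.2| ^ p ∂ν ≤ ENNReal.ofReal (5 ^ ((d : ℝ) + σ)) *
      ∫⁻ x, ∫⁻ y, ENNReal.ofReal (|u x - u y| ^ p * ‖x - y‖ ^ (-((d : ℝ) + σ))) := by
    rw [hν, lintegral_withDensity_eq_lintegral_mul _ hw (by fun_prop),
      lintegral_prod _ (by fun_prop), ← lintegral_const_mul' _ _ ENNReal.ofReal_ne_top]
    refine lintegral_mono fun x ↦ ?_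
    rw [← lintegral_const_mul' _ _ ENNReal.ofReal_ne_top]
    refine lintegral_mono fun y ↦ ?_
    simp only [Pi.mul_apply]
    rw [ENNReal.ofReal_rpow_of_nonneg (abs_nonneg _) hp0.le]
    exact dyadicWeight_mul_le hσ hp0 u x y
  have h3 : ∫⁻ q, ENNReal.ofReal |u q.2| ^ p ∂ν ≤
      annulusMass d * (ENNReal.ofReal ((1 / 2) ^ ((d : ℝ) - σ)) *
        ∫⁻ x, ENNReal.ofReal (|u x| ^ p * ‖x‖ ^ (-σ))) := by
    rw [hν, lintegral_withDensity_eq_lintegral_mul _ hw (by fun_prop),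
      lintegral_prod_symm _ (by fun_prop), ← lintegral_const_mul' _ _ ENNReal.ofReal_ne_top,
      ← lintegral_const_mul' _ _ hM]
    refine lintegral_mono fun y ↦ ?_
    simp only [Pi.mul_apply]
    rw [lintegral_mul_const _ (by fun_prop)]
    refine (mul_le_mul_left (lintegral_dyadicWeight_left_le hd hσd y) _).trans_eq ?_
    rw [ENNReal.ofReal_mul (by positivity), ENNReal.ofReal_mul (by positivity),
      ENNReal.ofReal_rpow_of_nonneg (abs_nonneg _) hp0.le]
    ring
  rw [← h1]
  exact (ENNReal.rpow_le_rpow hle (by positivity)).trans (hmink.trans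
    (add_le_add (ENNReal.rpow_le_rpow h2 (by positivity)) (ENNReal.rpow_le_rpow h3 (by positivity))))

lemma HSright_zero_zero (d : ℕ) (p β : ℝ) (u : EuclideanSpace ℝ (Fin d) → ℝ) :
    HSright d p 0 0 β u =
      (∫⁻ x, ∫⁻ y, ENNReal.ofReal (|u x - u y| ^ p * ‖x - y‖ ^ (-β))) ^ (1 / p) := by
  simp [HSright]

lemma HSleft_ne_top {d : ℕ} (hd : 1 ≤ d) {σ p : ℝ} (hσd : σ < d) (hp : 0 < p)
    {u : EuclideanSpace ℝ (Fin d) → ℝ} (hu : Continuous u) (hc : HasCompactSupport u) :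
    HSleft d p σ u ≠ ∞ := by
  refine ENNReal.rpow_ne_top_of_nonneg (by positivity) ?_
  obtain ⟨B, hB⟩ := hc.exists_bound_of_continuous hu
  obtain ⟨r, hr, hsub⟩ := hc.isCompact.isBounded.subset_ball_lt 0 0
  have hJint : IntegrableOn (fun x : EuclideanSpace ℝ (Fin d) ↦ B ^ p * ‖x‖ ^ (-σ))
      (Metric.ball 0 r) := Integrable.const_mul (integrableOn_ball_norm_rpow hd hσd hr) _
  rw [← integrable_indicator_iff measurableSet_ball] at hJint
  refine ne_top_of_le_ne_top hJint.lintegral_lt_top.ne (lintegral_mono fun x ↦ ?_)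
  refine ENNReal.ofReal_le_ofReal ?_
  by_cases hx : x ∈ Metric.ball (0 : EuclideanSpace ℝ (Fin d)) r
  · rw [Set.indicator_of_mem hx]
    have : |u x| ≤ B := hB x
    gcongr
  · rw [Set.indicator_of_notMem hx, image_eq_zero_of_notMem_tsupport fun h ↦ hx (hsub h)]
    simp [Real.zero_rpow hp.ne']

lemma div_le_one_sub_exp_neg {z D : ℝ} (hz : 0 ≤ z) (hzD : z ≤ D) :
    z / (1 + D) ≤ 1 - Real.exp (-z) := by
  have h1 : z + 1 ≤ Real.exp z := Real.add_one_le_exp z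
  have h2 : Real.exp (-z) ≤ 1 / (1 + z) := by
    rw [Real.exp_neg, ← one_div]
    exact one_div_le_one_div_of_le (by linarith) (by linarith)
  have h3 : z / (1 + D) ≤ z / (1 + z) := by gcongr
  have h4 : z / (1 + z) = 1 - 1 / (1 + z) := by field_simp; ring
  linarith

lemma ENNReal.ofReal_one_sub_mul_le {a b : ℝ≥0∞} {τ : ℝ} (hτ0 : 0 ≤ τ) (hτ1 : τ ≤ 1) (ha : a ≠ ∞)
    (h : a ≤ b + ENNReal.ofReal τ * a) : ENNReal.ofReal (1 - τ) * a ≤ b := by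
  have h1 : a = ENNReal.ofReal (1 - τ) * a + ENNReal.ofReal τ * a := by
    rw [← add_mul, ← ENNReal.ofReal_add (by linarith) hτ0]; simp
  rw [h1] at h
  refine (ENNReal.add_le_add_iff_right (ENNReal.mul_ne_top ENNReal.ofReal_ne_top ha)).1 (h.trans ?_)
  rw [← h1]

/-- An explicit admissible constant in the fractional Hardy inequality. -/
noncomputable def hardyConst (d : ℕ) (lam : ℝ) : ℝ :=
  5 ^ (2 * (d : ℝ)) / (d * lam * Real.log 2 / (1 + d) * min 1 (annulusMass d).toReal)

lemma annulusMass_toReal_pos {d : ℕ} (hd : 1 ≤ d) : 0 < (annulusMass d).toReal :=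
  ENNReal.toReal_pos (lintegral_annulus_pos hd).ne' (lintegral_annulus_ne_top d)

lemma hardyConst_pos {d : ℕ} (hd : 1 ≤ d) {lam : ℝ} (hlam : 0 < lam) : 0 < hardyConst d lam := by
  have h1 := annulusMass_toReal_pos hd
  have h2 : (0 : ℝ) < d := by exact_mod_cast hd
  have h3 := Real.log_pos one_lt_two
  have h4 : 0 < min 1 (annulusMass d).toReal := lt_min one_pos h1
  unfold hardyConst
  positivity

lemma HSleft_le_mul_HSright {d : ℕ} (hd : 1 ≤ d) {lam p : ℝ} (hlam : 0 < lam)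
    (hp : p ∈ Set.Ioo 1 (1 / lam)) {u : EuclideanSpace ℝ (Fin d) → ℝ} (hu : Continuous u)
    (hc : HasCompactSupport u) :
    HSleft d p (lam * d * p) u ≤ ENNReal.ofReal (hardyConst d lam * (p / (1 / lam - p))) *
      HSright d p 0 0 ((d : ℝ) * (1 + lam * p)) u := by
  obtain ⟨hp1, hp2⟩ := hp
  have hp0 : 0 < p := by linarith
  have hd0 : (0 : ℝ) < d := by exact_mod_cast hd
  have hlp : lam * p < 1 := by rwa [lt_div_iff₀ hlam, mul_comm] at hp2
  set σ := lam * d * p with hσdef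
  have hσ : 0 < σ := by positivity
  have hσd : σ < d := by rw [hσdef]; nlinarith
  have hβ : (d : ℝ) * (1 + lam * p) = d + σ := by rw [hσdef]; ring
  have hinv : 0 ≤ 1 / p := by positivity
  have hinv_le : 1 / p ≤ 1 := by rw [div_le_one hp0]; exact hp1.le
  have hmain := annulusMass_mul_lintegral_rpow_le hd hσ hσd hp1.le hu.measurable
  rw [ENNReal.mul_rpow_of_nonneg _ _ hinv, ENNReal.mul_rpow_of_nonneg _ _ hinv,
    ENNReal.mul_rpow_of_nonneg _ _ hinv, ENNReal.mul_rpow_of_nonneg _ _ hinv, ← HSright_zero_zero,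
    ← hβ, ENNReal.ofReal_rpow_of_nonneg (by positivity) hinv,
    ENNReal.ofReal_rpow_of_nonneg (by positivity) hinv, mul_left_comm] at hmain
  change _ * HSleft d p σ u ≤ _ + _ * (_ * HSleft d p σ u) at hmain
  have hL := HSleft_ne_top hd hσd hp0 hu hc
  set L := HSleft d p σ u
  set R := HSright d p 0 0 ((d : ℝ) * (1 + lam * p)) u
  set z := Real.log 2 * (((d : ℝ) - σ) / p) with hz
  have hτ : (((1 : ℝ) / 2) ^ ((d : ℝ) - σ)) ^ (1 / p) = Real.exp (-z) := by
    rw [← Real.rpow_mul (by norm_num), Real.rpow_def_of_pos (by norm_num), one_div, Real.log_inv, hz]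
    congr 1; ring
  have hlog := Real.log_pos one_lt_two
  have hz0 : 0 ≤ z := by
    have : 0 < (d : ℝ) - σ := by linarith
    positivity
  have hzd : z ≤ d := by
    have h1 : Real.log 2 ≤ 1 := by linarith [Real.log_two_lt_d9]
    have h2 : ((d : ℝ) - σ) / p ≤ d := by
      rw [div_le_iff₀ hp0]; nlinarith
    have h3 : 0 ≤ ((d : ℝ) - σ) / p := div_nonneg (by linarith) hp0.le
    rw [hz]; nlinarith
  rw [hτ] at hmain
  have hM := lintegral_annulus_ne_top d
  have key := ENNReal.ofReal_one_sub_mul_le (Real.exp_pos _).le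
    (Real.exp_le_one_iff.2 (by linarith)) (ENNReal.mul_ne_top
      (ENNReal.rpow_ne_top_of_nonneg hinv hM) hL) hmain
  set m := min 1 (annulusMass d).toReal with hm
  have hm0 : 0 < m := lt_min one_pos (annulusMass_toReal_pos hd)
  have hmM : ENNReal.ofReal m ≤ annulusMass d ^ (1 / p) := by
    calc ENNReal.ofReal m ≤ ENNReal.ofReal (m ^ (1 / p)) := by
          refine ENNReal.ofReal_le_ofReal ?_
          simpa using Real.rpow_le_rpow_of_exponent_ge hm0 (min_le_left _ _) hinv_le
      _ = ENNReal.ofReal m ^ (1 / p) := (ENNReal.ofReal_rpow_of_nonneg hm0.le hinv).symm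
      _ ≤ annulusMass d ^ (1 / p) := by
          refine ENNReal.rpow_le_rpow ?_ hinv
          exact (ENNReal.ofReal_le_ofReal (min_le_right _ _)).trans ENNReal.ofReal_toReal_le
  set κ := d * lam * Real.log 2 / (1 + d) with hκ
  have hκ0 : 0 < κ := by positivity
  have hq : 0 < 1 / lam - p := by linarith
  have hκz : κ * ((1 / lam - p) / p) ≤ 1 - Real.exp (-z) := by
    refine le_of_eq_of_le ?_ (div_le_one_sub_exp_neg hz0 hzd)
    rw [hκ, hz, hσdef]; field_simp
  have h5 : ((5 : ℝ) ^ ((d : ℝ) + σ)) ^ (1 / p) ≤ 5 ^ (2 * (d : ℝ)) := by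
    rw [← Real.rpow_mul (by norm_num)]
    refine Real.rpow_le_rpow_of_exponent_le (by norm_num) ?_
    nlinarith [mul_le_mul_of_nonneg_left hinv_le (show 0 ≤ (d : ℝ) + σ by positivity)]
  have hfin : ENNReal.ofReal (κ * ((1 / lam - p) / p) * m) * L ≤
      ENNReal.ofReal (5 ^ (2 * (d : ℝ))) * R := by
    calc ENNReal.ofReal (κ * ((1 / lam - p) / p) * m) * L
        = ENNReal.ofReal (κ * ((1 / lam - p) / p)) * (ENNReal.ofReal m * L) := by
          rw [ENNReal.ofReal_mul (by positivity), mul_assoc]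
      _ ≤ ENNReal.ofReal (1 - Real.exp (-z)) * (annulusMass d ^ (1 / p) * L) := by gcongr
      _ ≤ _ := key
      _ ≤ _ := by rw [hβ]; gcongr
  have hpos : 0 < κ * ((1 / lam - p) / p) * m := by positivity
  have hC : hardyConst d lam * (p / (1 / lam - p)) =
      (κ * ((1 / lam - p) / p) * m)⁻¹ * 5 ^ (2 * (d : ℝ)) := by
    rw [hardyConst, ← hκ, ← hm]; field_simp
  rw [hC, ENNReal.ofReal_mul (by positivity), mul_assoc, ENNReal.ofReal_inv_of_pos hpos,
    mul_comm, ← div_eq_mul_inv,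
    ENNReal.le_div_iff_mul_le (Or.inl (by simpa using hpos)) (Or.inl ENNReal.ofReal_ne_top), mul_comm]
  exact hfin

/-- An integrable majorant, uniform in `p`, of the kernel `min(|z|, 1)^p |z|^{-d-sp}`. -/
noncomputable def kernelMajorant (d : ℕ) (s : ℝ) (z : EuclideanSpace ℝ (Fin d)) : ℝ :=
  (Metric.ball (0 : EuclideanSpace ℝ (Fin d)) 1).indicator (fun z ↦ ‖z‖ ^ (-((d : ℝ) - (1 - s)))) z +
    2 ^ ((d : ℝ) + s) * (1 + ‖z‖) ^ (-((d : ℝ) + s))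

lemma integrable_kernelMajorant {d : ℕ} (hd : 1 ≤ d) {s : ℝ} (hs0 : 0 < s) (hs1 : s < 1) :
    Integrable (kernelMajorant d s) := by
  refine Integrable.add ?_ (Integrable.const_mul ?_ _)
  · rw [integrable_indicator_iff measurableSet_ball]
    exact integrableOn_ball_norm_rpow hd (by linarith) one_pos
  · exact integrable_one_add_norm (by simpa using hs0)

lemma min_rpow_mul_rpow_le_kernelMajorant {d : ℕ} {s p : ℝ} (hs0 : 0 < s) (hs1 : s < 1)
    (hp : 1 ≤ p) (z : EuclideanSpace ℝ (Fin d)) :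
    min ‖z‖ 1 ^ p * ‖z‖ ^ (-((d : ℝ) + s * p)) ≤ kernelMajorant d s z := by
  have hnn : 0 ≤ 2 ^ ((d : ℝ) + s) * (1 + ‖z‖) ^ (-((d : ℝ) + s)) := by positivity
  have hp0 : 0 < p := by linarith
  rcases lt_or_ge ‖z‖ 1 with h | h
  · rw [kernelMajorant, Set.indicator_of_mem (by simpa using h), min_eq_left h.le]
    refine le_add_of_le_of_nonneg ?_ hnn
    rcases eq_or_ne z 0 with rfl | hz
    · rw [norm_zero, Real.zero_rpow hp0.ne', zero_mul]
      positivity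
    have hz' : 0 < ‖z‖ := norm_pos_iff.2 hz
    rw [← Real.rpow_add hz']
    exact Real.rpow_le_rpow_of_exponent_ge hz' h.le (by nlinarith)
  · rw [kernelMajorant, Set.indicator_of_notMem (by simpa using h), min_eq_right h, zero_add,
      Real.one_rpow, one_mul]
    have hz' : 0 < ‖z‖ := by linarith
    calc ‖z‖ ^ (-((d : ℝ) + s * p)) ≤ ‖z‖ ^ (-((d : ℝ) + s)) :=
          Real.rpow_le_rpow_of_exponent_le h (by nlinarith)
      _ = 2 ^ ((d : ℝ) + s) * (2 * ‖z‖) ^ (-((d : ℝ) + s)) := by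
          rw [Real.mul_rpow (by norm_num) hz'.le, ← mul_assoc, ← Real.rpow_add (by norm_num)]
          simp
      _ ≤ _ := by
          gcongr ?_ * ?_
          refine Real.rpow_le_rpow_of_nonpos (by positivity) (by linarith) ?_
          have : (0 : ℝ) ≤ d := d.cast_nonneg
          linarith

lemma exists_abs_sub_le_mul_min {d : ℕ} {u : EuclideanSpace ℝ (Fin d) → ℝ}
    (hu : ContDiff ℝ (⊤ : ℕ∞) u) (hc : HasCompactSupport u) :
    ∃ K : ℝ, 1 ≤ K ∧ ∀ x y, |u x - u y| ≤ K * min ‖x - y‖ 1 := by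
  obtain ⟨C, hC⟩ := hu.lipschitzWith_of_hasCompactSupport hc (by simp)
  obtain ⟨B, hB⟩ := hc.exists_bound_of_continuous hu.continuous
  refine ⟨max 1 (max C (2 * B)), le_max_left _ _, fun x y ↦ ?_⟩
  rw [mul_min_of_nonneg _ _ (by positivity)]
  refine le_min ?_ ?_
  · have h1 := hC.dist_le_mul x y
    rw [Real.dist_eq, dist_eq_norm] at h1
    refine h1.trans ?_
    gcongr
    exact (le_max_left _ _).trans (le_max_right _ _)
  · have h1 : |u x| ≤ B := hB x
    have h2 : |u y| ≤ B := hB y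
    have h3 : 2 * B ≤ max 1 (max (C : ℝ) (2 * B)) := (le_max_right _ _).trans (le_max_right _ _)
    linarith [abs_sub (u x) (u y)]

lemma exists_HSright_le {d : ℕ} (hd : 1 ≤ d) {lam : ℝ} (hlam : 0 < lam) (hs : lam * d < 1)
    {u : EuclideanSpace ℝ (Fin d) → ℝ} (hu : ContDiff ℝ (⊤ : ℕ∞) u) (hc : HasCompactSupport u) :
    ∃ A : ℝ, 1 ≤ A ∧ ∀ p ∈ Set.Ioo 1 (1 / lam),
      HSright d p 0 0 ((d : ℝ) * (1 + lam * p)) u ≤ ENNReal.ofReal A := by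
  obtain ⟨K, hK1, hK⟩ := exists_abs_sub_le_mul_min hu hc
  have hd0 : (0 : ℝ) < d := by exact_mod_cast hd
  have hs0 : 0 < lam * d := by positivity
  have hGint := (integrable_kernelMajorant hd hs0 hs).const_mul (K ^ (1 / lam))
  have hGtop := hGint.lintegral_lt_top.ne
  have hGmeas : Measurable fun z ↦ ENNReal.ofReal (K ^ (1 / lam) * kernelMajorant d (lam * d) z) := by
    unfold kernelMajorant
    refine (Measurable.const_mul (Measurable.add ?_ (by fun_prop)) _).ennreal_ofReal
    exact Measurable.indicator (by fun_prop) measurableSet_ball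
  set G : EuclideanSpace ℝ (Fin d) → ℝ≥0∞ :=
    fun z ↦ ENNReal.ofReal (K ^ (1 / lam) * kernelMajorant d (lam * d) z) with hG
  set T := tsupport u with hT
  have hTm : MeasurableSet T := (isClosed_tsupport u).measurableSet
  have hTtop : volume T ≠ ∞ := hc.isCompact.measure_lt_top.ne
  set J : ℝ≥0∞ := volume T * (∫⁻ z, G z) + volume T * ∫⁻ z, G z with hJ
  have hJtop : J ≠ ∞ := by
    have := ENNReal.mul_ne_top hTtop hGtop
    exact ENNReal.add_ne_top.2 ⟨this, this⟩
  have h1 : ∫⁻ x, ∫⁻ y, T.indicator 1 x * G (x - y) = volume T * ∫⁻ z, G z := by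
    have : ∀ x, ∫⁻ y, T.indicator (1 : EuclideanSpace ℝ (Fin d) → ℝ≥0∞) x * G (x - y) =
        T.indicator (1 : EuclideanSpace ℝ (Fin d) → ℝ≥0∞) x * ∫⁻ z, G z := fun x ↦ by
      rw [lintegral_const_mul _ (by fun_prop), lintegral_sub_left_eq_self G x]
    simp_rw [this]
    rw [lintegral_mul_const _ (measurable_one.indicator hTm), lintegral_indicator_one hTm]
  have hind : Measurable (T.indicator (1 : EuclideanSpace ℝ (Fin d) → ℝ≥0∞)) :=
    measurable_one.indicator hTm
  have h2 : ∫⁻ x, ∫⁻ y, T.indicator 1 y * G (x - y) = volume T * ∫⁻ z, G z := by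
    rw [lintegral_lintegral_swap (by fun_prop)]
    have : ∀ y, ∫⁻ x, T.indicator (1 : EuclideanSpace ℝ (Fin d) → ℝ≥0∞) y * G (x - y) =
        T.indicator (1 : EuclideanSpace ℝ (Fin d) → ℝ≥0∞) y * ∫⁻ z, G z := fun y ↦ by
      rw [lintegral_const_mul _ (by fun_prop), lintegral_sub_right_eq_self G y]
    simp_rw [this]
    rw [lintegral_mul_const _ hind, lintegral_indicator_one hTm]
  refine ⟨max 1 J.toReal, le_max_left _ _, fun p hp ↦ ?_⟩
  have hp0 : 0 < p := one_pos.trans hp.1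
  have hJint : ∫⁻ x, ∫⁻ y, ENNReal.ofReal (|u x - u y| ^ p * ‖x - y‖ ^
      (-((d : ℝ) * (1 + lam * p)))) ≤ J := by
    rw [hJ]
    nth_rw 1 [← h1]
    rw [← h2, ← lintegral_add_left (by fun_prop)]
    refine lintegral_mono fun x ↦ ?_
    rw [← lintegral_add_left (by fun_prop)]
    refine lintegral_mono fun y ↦ ?_
    have hle : ENNReal.ofReal (|u x - u y| ^ p * ‖x - y‖ ^ (-((d : ℝ) * (1 + lam * p)))) ≤
        G (x - y) := by
      refine ENNReal.ofReal_le_ofReal ?_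
      have hm : 0 ≤ min ‖x - y‖ 1 := le_min (norm_nonneg _) zero_le_one
      calc |u x - u y| ^ p * ‖x - y‖ ^ (-((d : ℝ) * (1 + lam * p)))
          ≤ (K * min ‖x - y‖ 1) ^ p * ‖x - y‖ ^ (-((d : ℝ) * (1 + lam * p))) := by
            gcongr
            exact hK x y
        _ = K ^ p * (min ‖x - y‖ 1 ^ p * ‖x - y‖ ^ (-((d : ℝ) + lam * d * p))) := by
            rw [Real.mul_rpow (by linarith) hm, mul_assoc]
            congr 4; ring
        _ ≤ K ^ (1 / lam) * kernelMajorant d (lam * d) (x - y) := by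
            gcongr
            · exact hp.2.le
            · exact min_rpow_mul_rpow_le_kernelMajorant hs0 hs hp.1.le (x - y)
    by_cases hx : x ∈ T
    · simpa [hx] using hle.trans le_self_add
    by_cases hy : y ∈ T
    · simpa [hx, hy] using hle
    · rw [image_eq_zero_of_notMem_tsupport hx, image_eq_zero_of_notMem_tsupport hy]
      simp [Real.zero_rpow hp0.ne']
  rw [HSright_zero_zero]
  have hA : J ≤ ENNReal.ofReal (max 1 J.toReal) :=
    (ENNReal.ofReal_toReal hJtop).symm.le.trans (ENNReal.ofReal_le_ofReal (le_max_right _ _))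
  calc _ ≤ ENNReal.ofReal (max 1 J.toReal) ^ (1 / p) :=
        ENNReal.rpow_le_rpow (hJint.trans hA) (by positivity)
    _ ≤ ENNReal.ofReal (max 1 J.toReal) ^ (1 : ℝ) := by
        refine ENNReal.rpow_le_rpow_of_exponent_le (by simp) ?_
        rw [div_le_one hp0]
        exact hp.1.le
    _ = _ := ENNReal.rpow_one _

lemma ofReal_le_HSleft {d : ℕ} (hd : 1 ≤ d) {lam p : ℝ} (hlam : 0 < lam)
    (hp : p ∈ Set.Ioo 1 (1 / lam)) {u : EuclideanSpace ℝ (Fin d) → ℝ}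
    (hu : ∀ x ∈ Metric.ball (0 : EuclideanSpace ℝ (Fin d)) 1, u x = 1) :
    ENNReal.ofReal (min 1 (volume.real (Metric.ball (0 : EuclideanSpace ℝ (Fin d)) 1)) *
      (p / (1 / lam - p)) ^ lam) ≤ HSleft d p (lam * d * p) u := by
  obtain ⟨hp1, hp2⟩ := hp
  have hp0 : 0 < p := by linarith
  have hd0 : (0 : ℝ) < d := by exact_mod_cast hd
  have hlp : lam * p < 1 := by rwa [lt_div_iff₀ hlam, mul_comm] at hp2
  have hσd : lam * d * p < d := by nlinarith
  have hq : 0 < 1 / lam - p := by linarith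
  have hinv : 0 ≤ 1 / p := by positivity
  have hinv_le : 1 / p ≤ 1 := by rw [div_le_one hp0]; exact hp1.le
  set V := volume.real (Metric.ball (0 : EuclideanSpace ℝ (Fin d)) 1) with hV
  have hV0 : 0 < V := ENNReal.toReal_pos (Metric.measure_ball_pos _ _ one_pos).ne'
    measure_ball_lt_top.ne
  have hm0 : 0 < min 1 V := lt_min one_pos hV0
  set Q := 1 / (lam * (1 / lam - p)) with hQ
  have hlq : 0 < lam * (1 / lam - p) := by positivity
  have hQ1 : 1 ≤ Q := by
    rw [hQ, le_div_iff₀ hlq, mul_sub, mul_one_div_cancel hlam.ne']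
    nlinarith
  have hpQ : p / (1 / lam - p) ≤ Q := by
    rw [hQ, ← div_div]
    gcongr
  have hI : ENNReal.ofReal (V * Q) ≤
      ∫⁻ x, ENNReal.ofReal (|u x| ^ p * ‖x‖ ^ (-(lam * d * p))) := by
    have h1 := setIntegral_ball_norm_rpow hd hσd
    have h2 : V * Q = d * V / (d - lam * d * p) := by
      have h3 : (d : ℝ) - lam * d * p = d * (lam * (1 / lam - p)) := by
        rw [mul_sub lam, mul_one_div_cancel hlam.ne']; ring
      rw [h3, hQ]; field_simp
    rw [h2, ← h1, ofReal_integral_eq_lintegral_ofReal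
      (integrableOn_ball_norm_rpow hd hσd one_pos) (ae_of_all _ fun x ↦ by positivity)]
    calc _ = ∫⁻ x in Metric.ball (0 : EuclideanSpace ℝ (Fin d)) 1,
          ENNReal.ofReal (|u x| ^ p * ‖x‖ ^ (-(lam * d * p))) := by
          refine setLIntegral_congr_fun measurableSet_ball fun x hx ↦ ?_
          simp [hu x hx]
      _ ≤ _ := setLIntegral_le_lintegral _ _
  calc ENNReal.ofReal (min 1 V * (p / (1 / lam - p)) ^ lam)
      ≤ ENNReal.ofReal ((V * Q) ^ (1 / p)) := by
        refine ENNReal.ofReal_le_ofReal ?_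
        rw [Real.mul_rpow hV0.le (by positivity)]
        refine mul_le_mul ?_ ?_ (by positivity) (by positivity)
        · calc min 1 V ≤ min 1 V ^ (1 / p) := by
                simpa using Real.rpow_le_rpow_of_exponent_ge hm0 (min_le_left _ _) hinv_le
            _ ≤ V ^ (1 / p) := by
                gcongr
                exact min_le_right _ _
        · calc (p / (1 / lam - p)) ^ lam ≤ Q ^ lam := by gcongr
            _ ≤ Q ^ (1 / p) := by
                refine Real.rpow_le_rpow_of_exponent_le hQ1 ?_
                rw [le_div_iff₀ hp0]
                exact hlp.le
    _ = ENNReal.ofReal (V * Q) ^ (1 / p) :=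
        (ENNReal.ofReal_rpow_of_nonneg (by positivity) hinv).symm
    _ ≤ _ := ENNReal.rpow_le_rpow hI hinv

/-- Theorem 4.a: two-sided bounds for the optimal fractional
Hardy–Sobolev constant with `μ(p) = λdp`, `β(p) = d(1+λp)`, `α₁ = α₂ = 0`. -/
theorem optimal_HS_constant_bounds
    (d : ℕ) (hd : 1 ≤ d) (lam : ℝ)
    (hlam : lam ∈ Set.Ioo (0 : ℝ) (1 / (2 * (d : ℝ) - 1))) :
    ∃ C₁ C₂ : ℝ, 0 < C₁ ∧ 0 < C₂ ∧
      ∀ p ∈ Set.Ioo (1 : ℝ) (1 / lam),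
        ENNReal.ofReal (C₁ * (p / (1 / lam - p)) ^ lam)
            ≤ HSoptConst d p (lam * d * p) 0 0 ((d : ℝ) * (1 + lam * p)) ∧
          HSoptConst d p (lam * d * p) 0 0 ((d : ℝ) * (1 + lam * p))
            ≤ ENNReal.ofReal (C₂ * (p / (1 / lam - p))) := by
  obtain ⟨hlam0, hlam1⟩ := hlam
  have hd1 : (1 : ℝ) ≤ d := by exact_mod_cast hd
  have hs : lam * d < 1 := by
    rw [lt_div_iff₀ (by linarith)] at hlam1
    nlinarith
  let φ : ContDiffBump (0 : EuclideanSpace ℝ (Fin d)) := ⟨1, 2, one_pos, one_lt_two⟩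
  have hφ : ContDiff ℝ (⊤ : ℕ∞) φ := φ.contDiff
  have hφc : HasCompactSupport φ := φ.hasCompactSupport
  have hφ1 : ∀ x ∈ Metric.ball (0 : EuclideanSpace ℝ (Fin d)) 1, φ x = 1 := fun x hx ↦
    φ.one_of_mem_closedBall (Metric.ball_subset_closedBall hx)
  obtain ⟨A, hA1, hA⟩ := exists_HSright_le hd hlam0 hs hφ hφc
  have hA0 : 0 < A := by linarith
  set m := min 1 (volume.real (Metric.ball (0 : EuclideanSpace ℝ (Fin d)) 1)) with hm
  have hm0 : 0 < m := lt_min one_pos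
    (ENNReal.toReal_pos (Metric.measure_ball_pos _ _ one_pos).ne' measure_ball_lt_top.ne)
  refine ⟨m / A, hardyConst d lam, by positivity, hardyConst_pos hd hlam0, fun p hp ↦ ⟨?_, ?_⟩⟩
  · have hq : 0 < p / (1 / lam - p) := div_pos (one_pos.trans hp.1) (sub_pos.2 hp.2)
    have hL := ofReal_le_HSleft hd hlam0 hp hφ1
    have hR0 : HSright d p 0 0 ((d : ℝ) * (1 + lam * p)) φ ≠ 0 := by
      intro h0
      have h := hL.trans (HSleft_le_mul_HSright hd hlam0 hp hφ.continuous hφc)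
      rw [h0, mul_zero, nonpos_iff_eq_zero, ENNReal.ofReal_eq_zero] at h
      have : 0 < m * (p / (1 / lam - p)) ^ lam := by positivity
      exact this.not_ge h
    calc ENNReal.ofReal (m / A * (p / (1 / lam - p)) ^ lam)
        = ENNReal.ofReal (m * (p / (1 / lam - p)) ^ lam) / ENNReal.ofReal A := by
          rw [← ENNReal.ofReal_div_of_pos hA0]; congr 1; ring
      _ ≤ HSleft d p (lam * d * p) φ / HSright d p 0 0 ((d : ℝ) * (1 + lam * p)) φ :=
          ENNReal.div_le_div hL (hA p hp)
      _ ≤ _ := le_iSup (fun u : {u : EuclideanSpace ℝ (Fin d) → ℝ //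
            ContDiff ℝ (⊤ : ℕ∞) u ∧ HasCompactSupport u ∧
              HSright d p 0 0 ((d : ℝ) * (1 + lam * p)) u ≠ 0} ↦
          HSleft d p (lam * d * p) u.1 / HSright d p 0 0 ((d : ℝ) * (1 + lam * p)) u.1)
          ⟨φ, hφ, hφc, hR0⟩
  · refine iSup_le fun u ↦ ENNReal.div_le_of_le_mul ?_
    exact HSleft_le_mul_HSright hd hlam0 hp u.2.1.continuous u.2.2.1
end
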